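/- arXiv:2008.11904 — 8 statements merged into one kernel-verified Lean document; each statement's English description precedes it below -/
import Mathlib

section
/- Let d ≥ 1, let G be a real symmetric d×d matrix with smallest eigenvalue σ_min(G), let b ∈ ℝ^d, and let r > 0. Then the minimum of the (generally non-convex) trust-region subproblem min { bᵀρ + (1/2) ρᵀGρ : ρ ∈ ℝ^d, ‖ρ‖ = r } equals sup over t > −σ_min(G) of the expression −(1/2) bᵀ (G + t I_d)⁻¹ b − (t/2) r². -/
open Matrix

section TrustRegion

variable {n : Type*} [Fintype n] {G : Matrix n n ℝ}

/-- The trust-region objective `bᵀρ + (1/2) ρᵀGρ`. -/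
noncomputable def trustRegionObjective (G : Matrix n n ℝ) (b ρ : n → ℝ) : ℝ :=
  b ⬝ᵥ ρ + (1 / 2) * (ρ ⬝ᵥ G *ᵥ ρ)

theorem Matrix.IsHermitian.dotProduct_mulVec_comm (hG : G.IsHermitian) (x y : n → ℝ) :
    x ⬝ᵥ G *ᵥ y = y ⬝ᵥ G *ᵥ x := by
  have hT : Gᵀ = G := by simpa using hG.eq
  rw [dotProduct_mulVec, ← mulVec_transpose, hT, dotProduct_comm]

/-- A function continuous on `ℝ` and nonnegative on the positive reals is nonnegative at `0`. -/
theorem Continuous.nonneg_zero_of_forall_pos {f : ℝ → ℝ} (hf : Continuous f)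
    (h : ∀ ε, 0 < ε → 0 ≤ f ε) : 0 ≤ f 0 :=
  ge_of_tendsto (hf.continuousWithinAt (s := Set.Ioi 0) (x := 0))
    (eventually_nhdsWithin_of_forall h)

theorem exists_isMinOn_sphere_trustRegionObjective [Nonempty n] (G : Matrix n n ℝ) (b : n → ℝ)
    {r : ℝ} (hr : 0 < r) :
    ∃ p : n → ℝ, p ⬝ᵥ p = r ^ 2 ∧ ∀ ρ : n → ℝ, ρ ⬝ᵥ ρ = r ^ 2 →
      trustRegionObjective G b p ≤ trustRegionObjective G b ρ := by
  classical
  have hclosed : IsClosed {ρ : n → ℝ | ρ ⬝ᵥ ρ = r ^ 2} :=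
    isClosed_eq (by fun_prop) continuous_const
  have hbdd : Bornology.IsBounded {ρ : n → ℝ | ρ ⬝ᵥ ρ = r ^ 2} := by
    refine (Metric.isBounded_closedBall (x := (0 : n → ℝ)) (r := r)).subset fun ρ hρ ↦ ?_
    rw [mem_closedBall_zero_iff, pi_norm_le_iff_of_nonneg hr.le]
    intro i
    refine abs_le_of_sq_le_sq (le_trans ?_ (Set.mem_ofPred.mp hρ).le) hr.le
    rw [sq]
    exact Finset.single_le_sum (f := fun i ↦ ρ i * ρ i) (fun j _ ↦ mul_self_nonneg (ρ j))
      (Finset.mem_univ i)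
  have hne : {ρ : n → ℝ | ρ ⬝ᵥ ρ = r ^ 2}.Nonempty :=
    ⟨Pi.single (Classical.arbitrary n) r, by simp [sq]⟩
  have hcont : Continuous (trustRegionObjective G b) := by
    unfold trustRegionObjective; fun_prop
  obtain ⟨p, hp, hmin⟩ :=
    (Metric.isCompact_of_isClosed_isBounded hclosed hbdd).exists_isMinOn hne hcont.continuousOn
  exact ⟨p, hp, fun ρ hρ ↦ hmin hρ⟩

/-- Comparing a minimizer on a sphere with its image under the reflection along `v`. -/
theorem trustRegion_reflection_nonneg (hG : G.IsHermitian) {b p : n → ℝ} {r : ℝ}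
    (hp : p ⬝ᵥ p = r ^ 2) (hmin : ∀ ρ : n → ℝ, ρ ⬝ᵥ ρ = r ^ 2 →
      trustRegionObjective G b p ≤ trustRegionObjective G b ρ) (v : n → ℝ) :
    0 ≤ -(p ⬝ᵥ v) * ((v ⬝ᵥ v) * ((G *ᵥ p + b) ⬝ᵥ v) - (p ⬝ᵥ v) * (v ⬝ᵥ G *ᵥ v)) := by
  rcases eq_or_ne v 0 with rfl | hv
  · simp
  have hN : v ⬝ᵥ v ≠ 0 := mt dotProduct_self_eq_zero.mp hv
  obtain ⟨s, hs⟩ : ∃ s : ℝ, s * (v ⬝ᵥ v) = -2 * (p ⬝ᵥ v) := ⟨_, div_mul_cancel₀ _ hN⟩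
  have hsphere : (p + s • v) ⬝ᵥ (p + s • v) = r ^ 2 := by
    simp only [add_dotProduct, dotProduct_add, smul_dotProduct, dotProduct_smul, smul_eq_mul,
      dotProduct_comm v p, hp]
    linear_combination s * hs
  have h := hmin _ hsphere
  simp only [trustRegionObjective, mulVec_add, mulVec_smul, add_dotProduct, dotProduct_add,
    smul_dotProduct, dotProduct_smul, smul_eq_mul, hG.dotProduct_mulVec_comm p v] at h
  rw [add_dotProduct, dotProduct_comm (G *ᵥ p) v]
  have hdiff : 0 ≤ s * (v ⬝ᵥ G *ᵥ p + b ⬝ᵥ v) + 1 / 2 * s ^ 2 * (v ⬝ᵥ G *ᵥ v) := by linarith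
  have hscaled := mul_nonneg hdiff (sq_nonneg (v ⬝ᵥ v))
  have hkey : (s * (v ⬝ᵥ G *ᵥ p + b ⬝ᵥ v) + 1 / 2 * s ^ 2 * (v ⬝ᵥ G *ᵥ v)) * (v ⬝ᵥ v) ^ 2 =
      2 * (-(p ⬝ᵥ v) * ((v ⬝ᵥ v) * (v ⬝ᵥ G *ᵥ p + b ⬝ᵥ v) - (p ⬝ᵥ v) * (v ⬝ᵥ G *ᵥ v))) := by
    linear_combination ((v ⬝ᵥ G *ᵥ p + b ⬝ᵥ v) * (v ⬝ᵥ v)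
      + 1 / 2 * (v ⬝ᵥ G *ᵥ v) * (s * (v ⬝ᵥ v) - 2 * (p ⬝ᵥ v))) * hs
  linarith

/-- First- and second-order optimality conditions for the equality-constrained trust-region
subproblem. -/
theorem exists_trustRegion_multiplier (hG : G.IsHermitian) {b p : n → ℝ} {r : ℝ} (hr : 0 < r)
    (hp : p ⬝ᵥ p = r ^ 2) (hmin : ∀ ρ : n → ℝ, ρ ⬝ᵥ ρ = r ^ 2 →
      trustRegionObjective G b p ≤ trustRegionObjective G b ρ) :
    ∃ t : ℝ, b = -(G *ᵥ p + t • p) ∧ ∀ v, 0 ≤ v ⬝ᵥ G *ᵥ v + t * (v ⬝ᵥ v) := by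
  have hrefl := trustRegion_reflection_nonneg hG hp hmin
  set g := G *ᵥ p + b with hg
  have hr2 : 0 < r ^ 2 := by positivity
  obtain ⟨t, ht⟩ : ∃ t : ℝ, t * r ^ 2 = -(p ⬝ᵥ g) := ⟨_, div_mul_cancel₀ _ hr2.ne'⟩
  have hpu : p ⬝ᵥ (g + t • p) = 0 := by
    rw [dotProduct_add, dotProduct_smul, hp, smul_eq_mul]; linarith
  set u := g + t • p with hu
  have hgu : g ⬝ᵥ u = u ⬝ᵥ u := by
    conv_rhs => rw [hu, add_dotProduct, ← hu, smul_dotProduct, hpu, smul_zero, add_zero]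
  have hu0 : u = 0 := by
    have h := Continuous.nonneg_zero_of_forall_pos
      (f := fun ε : ℝ ↦ ((-u - ε • p) ⬝ᵥ (-u - ε • p)) * (g ⬝ᵥ (-u - ε • p))
        + ε * r ^ 2 * ((-u - ε • p) ⬝ᵥ G *ᵥ (-u - ε • p))) (by fun_prop) fun ε hε ↦ by
        have hpv : p ⬝ᵥ (-u - ε • p) = -(ε * r ^ 2) := by
          simp [dotProduct_sub, hpu, hp]
        have h := hrefl (-u - ε • p)
        rw [hpv, neg_neg, neg_mul, sub_neg_eq_add] at h
        exact nonneg_of_mul_nonneg_right h (by positivity)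
    simp only [zero_smul, sub_zero, dotProduct_neg, neg_dotProduct, neg_neg, hgu, zero_mul,
      add_zero] at h
    exact dotProduct_self_eq_zero.mp (by nlinarith)
  have hgp : g = -(t • p) := eq_neg_of_add_eq_zero_left (hu ▸ hu0)
  refine ⟨t, ?_, ?_⟩
  · rw [neg_add, ← hgp, hg]; abel
  have hne : ∀ v, p ⬝ᵥ v ≠ 0 → 0 ≤ v ⬝ᵥ G *ᵥ v + t * (v ⬝ᵥ v) := fun v hv ↦ by
    have h := hrefl v
    rw [hgp, neg_dotProduct, smul_dotProduct, smul_eq_mul] at h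
    refine nonneg_of_mul_nonneg_right (a := (p ⬝ᵥ v) ^ 2) ?_ (by positivity)
    linarith
  intro v
  by_cases hv : p ⬝ᵥ v = 0
  · have h := Continuous.nonneg_zero_of_forall_pos
      (f := fun ε : ℝ ↦ (v + ε • p) ⬝ᵥ G *ᵥ (v + ε • p) + t * ((v + ε • p) ⬝ᵥ (v + ε • p)))
      (by fun_prop) fun ε hε ↦ hne _ (by
        rw [dotProduct_add, hv, dotProduct_smul, hp, zero_add, smul_eq_mul]; positivity)
    simpa using h
  · exact hne v hv

variable [DecidableEq n]

theorem Matrix.IsHermitian.posDef_add_smul_one (hG : G.IsHermitian) {t : ℝ}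
    (ht : ∀ i, -t < hG.eigenvalues i) : (G + t • (1 : Matrix n n ℝ)).PosDef := by
  have hM : (G + t • (1 : Matrix n n ℝ)).IsHermitian :=
    hG.add (isHermitian_one.smul (IsSelfAdjoint.all t))
  rw [hM.posDef_iff_eigenvalues_pos]
  intro i
  have h : hM.eigenvalues i ∈ spectrum ℝ (G + t • 1) := hM.eigenvalues_mem_spectrum_real i
  generalize hM.eigenvalues i = μ at h ⊢
  rw [← Algebra.algebraMap_eq_smul_one, ← spectrum.add_singleton_eq,
    hG.spectrum_real_eq_range_eigenvalues] at h
  obtain ⟨_, ⟨j, rfl⟩, x, hx, hj⟩ := h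
  change hG.eigenvalues j + x = μ at hj
  rw [Set.mem_singleton_iff.mp hx] at hj
  linarith [ht j]

theorem Matrix.IsHermitian.neg_eigenvalues_le (hG : G.IsHermitian) {t : ℝ}
    (ht : ∀ v : n → ℝ, 0 ≤ v ⬝ᵥ G *ᵥ v + t * (v ⬝ᵥ v)) (i : n) : -hG.eigenvalues i ≤ t := by
  have h := ht (hG.eigenvectorBasis i)
  rw [hG.mulVec_eigenvectorBasis, dotProduct_smul, smul_eq_mul, ← add_mul] at h
  have hne : (hG.eigenvectorBasis i : n → ℝ) ≠ 0 := fun h0 ↦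
    hG.eigenvectorBasis.orthonormal.ne_zero i (by ext j; exact congrFun h0 j)
  have hpos : 0 < (hG.eigenvectorBasis i : n → ℝ) ⬝ᵥ (hG.eigenvectorBasis i : n → ℝ) := by
    simpa using dotProduct_star_self_pos_iff.mpr hne
  linarith [nonneg_of_mul_nonneg_left h hpos]

theorem Matrix.PosDef.mulVec_inv_mulVec (hG : G.PosDef) (b : n → ℝ) : G *ᵥ (G⁻¹ *ᵥ b) = b := by
  rw [mulVec_mulVec, mul_nonsing_inv _ ((isUnit_iff_isUnit_det G).mp hG.isUnit), one_mulVec]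

end TrustRegion

/-- The optimal value of the equality-constrained trust-region subproblem
`min { bᵀρ + (1/2) ρᵀGρ : ‖ρ‖ = r }` equals
`sup_{t > -σ_min(G)} [ -(1/2) bᵀ(G + tI)⁻¹b - (t/2) r² ]`. -/
theorem trust_region_sup_representation
    (d : ℕ) (hd : 1 ≤ d) (G : Matrix (Fin d) (Fin d) ℝ) (hG : G.IsHermitian)
    (b : Fin d → ℝ) (r : ℝ) (hr : 0 < r) :
    sInf {v : ℝ | ∃ ρ : Fin d → ℝ, ρ ⬝ᵥ ρ = r ^ 2 ∧
        v = b ⬝ᵥ ρ + (1 / 2) * (ρ ⬝ᵥ G.mulVec ρ)} =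
    sSup {v : ℝ | ∃ t : ℝ,
        -(Finset.univ.inf' (Finset.univ_nonempty_iff.mpr ⟨⟨0, hd⟩⟩) hG.eigenvalues) < t ∧
        v = -(1 / 2) * (b ⬝ᵥ ((G + t • (1 : Matrix (Fin d) (Fin d) ℝ))⁻¹).mulVec b)
            - (t / 2) * r ^ 2} := by
  have : Nonempty (Fin d) := ⟨⟨0, hd⟩⟩
  obtain ⟨p, hp, hmin⟩ := exists_isMinOn_sphere_trustRegionObjective G b hr
  obtain ⟨s, hb, hs⟩ := exists_trustRegion_multiplier hG hr hp hmin
  have hshift : ∀ (t : ℝ) (x y : Fin d → ℝ),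
      x ⬝ᵥ (G + t • (1 : Matrix (Fin d) (Fin d) ℝ)) *ᵥ y = x ⬝ᵥ G *ᵥ y + t * (x ⬝ᵥ y) := by
    intro t x y
    simp [add_mulVec, smul_mulVec, dotProduct_add]
  have hpd : ∀ t, -(Finset.univ.inf' (Finset.univ_nonempty_iff.mpr ⟨⟨0, hd⟩⟩) hG.eigenvalues) < t →
      (G + t • (1 : Matrix (Fin d) (Fin d) ℝ)).PosDef := fun t ht ↦
    hG.posDef_add_smul_one fun i ↦
      (neg_lt.mp ht).trans_le (Finset.inf'_le _ (Finset.mem_univ i))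
  have hσs : -(Finset.univ.inf' (Finset.univ_nonempty_iff.mpr ⟨⟨0, hd⟩⟩) hG.eigenvalues) ≤ s := by
    obtain ⟨i, -, hi⟩ := Finset.exists_mem_eq_inf' (Finset.univ_nonempty_iff.mpr ⟨⟨0, hd⟩⟩)
      hG.eigenvalues
    rw [hi]
    exact hG.neg_eigenvalues_le hs i
  have hleast : IsLeast {v : ℝ | ∃ ρ : Fin d → ℝ, ρ ⬝ᵥ ρ = r ^ 2 ∧
      v = b ⬝ᵥ ρ + (1 / 2) * (ρ ⬝ᵥ G.mulVec ρ)} (trustRegionObjective G b p) :=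
    ⟨⟨p, hp, rfl⟩, by rintro _ ⟨ρ, hρ, rfl⟩; exact hmin ρ hρ⟩
  rw [hleast.csInf_eq]
  symm
  refine csSup_eq_of_forall_le_of_forall_lt_exists_gt ⟨_, s + 1, by linarith, rfl⟩ ?_ ?_
  · rintro _ ⟨t, ht, rfl⟩
    have hy := (hpd t ht).mulVec_inv_mulVec b
    set y := (G + t • (1 : Matrix (Fin d) (Fin d) ℝ))⁻¹ *ᵥ b
    have hnn := (hpd t ht).posSemidef.dotProduct_mulVec_nonneg (p + y)
    have hpy : p ⬝ᵥ (G + t • (1 : Matrix (Fin d) (Fin d) ℝ)) *ᵥ y = b ⬝ᵥ p := by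
      rw [hy, dotProduct_comm]
    have hyp : y ⬝ᵥ (G + t • (1 : Matrix (Fin d) (Fin d) ℝ)) *ᵥ p = b ⬝ᵥ p := by
      rw [(hpd t ht).isHermitian.dotProduct_mulVec_comm, hpy]
    have hyy : y ⬝ᵥ (G + t • (1 : Matrix (Fin d) (Fin d) ℝ)) *ᵥ y = b ⬝ᵥ y := by
      rw [hy, dotProduct_comm]
    rw [star_trivial, mulVec_add, add_dotProduct, dotProduct_add, dotProduct_add, hpy, hyp, hyy,
      hshift, hp] at hnn
    unfold trustRegionObjective
    linarith
  · intro w hw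
    obtain ⟨ε, hε, hwε⟩ : ∃ ε : ℝ, 0 < ε ∧ w < trustRegionObjective G b p - ε / 2 * r ^ 2 := by
      have hr2 : 0 < r ^ 2 := by positivity
      refine ⟨(trustRegionObjective G b p - w) / r ^ 2, div_pos (sub_pos.mpr hw) hr2, ?_⟩
      have : (trustRegionObjective G b p - w) / r ^ 2 / 2 * r ^ 2
          = (trustRegionObjective G b p - w) / 2 := by field_simp
      linarith
    refine ⟨_, ⟨s + ε, by linarith, rfl⟩, hwε.trans_le ?_⟩
    have hy := (hpd (s + ε) (by linarith)).mulVec_inv_mulVec b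
    set y := (G + (s + ε) • (1 : Matrix (Fin d) (Fin d) ℝ))⁻¹ *ᵥ b
    have hyy : y ⬝ᵥ G *ᵥ y + (s + ε) * (y ⬝ᵥ y) = b ⬝ᵥ y := by
      rw [← hshift, hy, dotProduct_comm]
    have hbx : ∀ x, b ⬝ᵥ x = -(x ⬝ᵥ G *ᵥ p + s * (p ⬝ᵥ x)) := fun x ↦ by
      rw [hb, neg_dotProduct, add_dotProduct, smul_dotProduct, smul_eq_mul,
        dotProduct_comm (G *ᵥ p)]
    have hnn := hs (y + p)
    simp only [mulVec_add, add_dotProduct, dotProduct_add, hG.dotProduct_mulVec_comm p y,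
      dotProduct_comm y p, hp] at hnn
    have hεy : 0 ≤ ε * (y ⬝ᵥ y) :=
      mul_nonneg hε.le (Finset.sum_nonneg fun i _ ↦ mul_self_nonneg (y i))
    have hby := hbx y
    have hbp := hbx p
    rw [hp] at hbp
    unfold trustRegionObjective
    linarith
end

section
/- Let ℓ : ℝ → ℝ be a convex function. Then the map (a, x) ↦ M_ℓ(a; x) is jointly convex on ℝ × (0, ∞), where M_ℓ(a; x) = inf_{z∈ℝ} [ ℓ(z) + (z − a)²/(2x) ] is the Moreau envelope of ℓ. -/
/-- A real-valued convex function on `ℝ` is minorized by an affine function. -/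
lemma ConvexOn.exists_affine_le {f : ℝ → ℝ} (hf : ConvexOn ℝ Set.univ f) :
    ∃ m c : ℝ, ∀ z, m * z + c ≤ f z := by
  have h0 : (0 : ℝ) ∈ interior (Set.univ : Set ℝ) := by simp
  refine ⟨derivWithin f (Set.Ioi 0) 0, f 0, fun z => ?_⟩
  rcases lt_trichotomy z 0 with hz | rfl | hz
  · have h := (hf.slope_le_leftDeriv_of_mem_interior (Set.mem_univ z) h0 hz).trans
      (hf.leftDeriv_le_rightDeriv_of_mem_interior h0)
    rw [slope_def_field, div_le_iff₀ (by linarith)] at h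
    linarith
  · simp
  · have h := hf.rightDeriv_le_slope_of_mem_interior h0 (Set.mem_univ z) hz
    rw [slope_def_field, le_div_iff₀ (by linarith)] at h
    linarith

/-- The objective defining the Moreau envelope of a convex function is bounded below. -/
lemma ConvexOn.bddBelow_range_add_sq_div {f : ℝ → ℝ} (hf : ConvexOn ℝ Set.univ f)
    (a : ℝ) {x : ℝ} (hx : 0 < x) :
    BddBelow (Set.range fun z : ℝ => f z + (z - a) ^ 2 / (2 * x)) := by
  obtain ⟨m, c, h⟩ := hf.exists_affine_le
  refine ⟨m * a + c - m ^ 2 * x / 2, ?_⟩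
  rintro _ ⟨z, rfl⟩
  have key : (z - a) ^ 2 / (2 * x) + m * (z - a) + m ^ 2 * x / 2
      = (z - a + m * x) ^ 2 / (2 * x) := by
    field_simp
    ring
  have hsq : 0 ≤ (z - a + m * x) ^ 2 / (2 * x) := by positivity
  have := h z
  dsimp only
  linarith

/-- Joint convexity of the perspective `(u, x) ↦ u ^ 2 / (2 * x)` of the halved square. -/
lemma sq_div_two_mul_convex_combination_le {s t x y : ℝ} (hs : 0 ≤ s) (ht : 0 ≤ t)
    (hx : 0 < x) (hy : 0 < y) (hw : 0 < s * x + t * y) (u v : ℝ) :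
    (s * u + t * v) ^ 2 / (2 * (s * x + t * y))
      ≤ s * (u ^ 2 / (2 * x)) + t * (v ^ 2 / (2 * y)) := by
  have key : s * (u ^ 2 / (2 * x)) + t * (v ^ 2 / (2 * y))
      - (s * u + t * v) ^ 2 / (2 * (s * x + t * y))
      = s * t * (u * y - v * x) ^ 2 / (2 * x * y * (s * x + t * y)) := by
    field_simp
    ring
  have : 0 ≤ s * t * (u * y - v * x) ^ 2 / (2 * x * y * (s * x + t * y)) := by positivity
  linarith


/-- For a convex `ℓ : ℝ → ℝ`, the Moreau envelope
`(a, x) ↦ M_ℓ(a; x) = inf_z [ ℓ(z) + (z − a)²/(2x) ]` is jointly convex on `ℝ × (0, ∞)`. -/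
theorem moreau_envelope_jointly_convex
    (ℓ : ℝ → ℝ) (hconv : ConvexOn ℝ Set.univ ℓ) :
    ConvexOn ℝ (Set.univ ×ˢ Set.Ioi (0 : ℝ))
      (fun p : ℝ × ℝ => ⨅ z : ℝ, (ℓ z + (z - p.1) ^ 2 / (2 * p.2))) := by
  have hS : Convex ℝ (Set.univ ×ˢ Set.Ioi (0 : ℝ) : Set (ℝ × ℝ)) :=
    convex_univ.prod (convex_Ioi 0)
  refine ⟨hS, ?_⟩
  rintro ⟨a, x⟩ hp ⟨b, y⟩ hq s t hs ht hst
  have hw : 0 < s * x + t * y := (hS hp hq hs ht hst).2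
  have hx : 0 < x := hp.2
  have hy : 0 < y := hq.2
  simp only [Prod.smul_mk, Prod.mk_add_mk, smul_eq_mul]
  refine le_of_forall_pos_le_add fun ε hε => ?_
  obtain ⟨z₁, h₁⟩ := exists_lt_of_ciInf_lt (lt_add_of_pos_right
    (⨅ z : ℝ, (ℓ z + (z - a) ^ 2 / (2 * x))) hε)
  obtain ⟨z₂, h₂⟩ := exists_lt_of_ciInf_lt (lt_add_of_pos_right
    (⨅ z : ℝ, (ℓ z + (z - b) ^ 2 / (2 * y))) hε)
  refine (ciInf_le (hconv.bddBelow_range_add_sq_div _ hw) (s * z₁ + t * z₂)).trans ?_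
  have hℓ := hconv.2 (Set.mem_univ z₁) (Set.mem_univ z₂) hs ht hst
  simp only [smul_eq_mul] at hℓ
  have hsq := sq_div_two_mul_convex_combination_le hs ht hx hy hw (z₁ - a) (z₂ - b)
  have hz : s * z₁ + t * z₂ - (s * a + t * b) = s * (z₁ - a) + t * (z₂ - b) := by ring
  have hε' : s * ε + t * ε = ε := by rw [← add_mul, hst, one_mul]
  rw [hz]
  linarith [mul_le_mul_of_nonneg_left h₁.le hs, mul_le_mul_of_nonneg_left h₂.le ht]
end

section
/- Let ℓ : ℝ → ℝ be a strictly convex function and let x > 0. Then the Moreau envelope a ↦ M_ℓ(a; x) = inf_{z∈ℝ} [ ℓ(z) + (z − a)²/(2x) ] is strictly convex on ℝ. -/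
/-- A real convex function on the line has an affine minorant touching it at a given point. -/
lemma ConvexOn.exists_affine_le_of_univ {f : ℝ → ℝ} (hf : ConvexOn ℝ Set.univ f) (y : ℝ) :
    ∃ c : ℝ, ∀ z : ℝ, f y + c * (z - y) ≤ f z := by
  have hy : y ∈ interior (Set.univ : Set ℝ) := by simp
  refine ⟨derivWithin f (Set.Ioi y) y, fun z => ?_⟩
  rcases lt_trichotomy z y with h | rfl | h
  · have h1 := (hf.slope_le_leftDeriv_of_mem_interior (Set.mem_univ z) hy h).trans
      (hf.leftDeriv_le_rightDeriv_of_mem_interior hy)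
    rw [slope_def_field, div_le_iff₀ (by linarith)] at h1
    linarith
  · simp
  · have h1 := hf.rightDeriv_le_slope_of_mem_interior hy (Set.mem_univ z) h
    rw [slope_def_field, le_div_iff₀ (by linarith)] at h1
    linarith

/-- The infimum defining the Moreau envelope of a convex function on the line is attained. -/
lemma ConvexOn.exists_forall_add_sq_div_le {f : ℝ → ℝ} (hf : ConvexOn ℝ Set.univ f)
    {x : ℝ} (hx : 0 < x) (a : ℝ) :
    ∃ w : ℝ, ∀ z : ℝ, f w + (w - a) ^ 2 / (2 * x) ≤ f z + (z - a) ^ 2 / (2 * x) := by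
  obtain ⟨c, hc⟩ := hf.exists_affine_le_of_univ a
  have hcont : Continuous f :=
    continuousOn_univ.1 (hf.continuousOn isOpen_univ)
  have hbound (z : ℝ) : dist z (a - c * x) + (f a - c ^ 2 * x / 2 - x / 2) ≤
      f z + (z - a) ^ 2 / (2 * x) := by
    have h1 : (z - a) ^ 2 / (2 * x) =
        (|z - (a - c * x)| - x) ^ 2 / (2 * x) + |z - (a - c * x)| - x / 2
          - c * (z - a) - c ^ 2 * x / 2 := by
      have h2 := sq_abs (z - (a - c * x))
      generalize |z - (a - c * x)| = u at h2 ⊢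
      field_simp
      linear_combination -h2
    have h3 : 0 ≤ (|z - (a - c * x)| - x) ^ 2 / (2 * x) := by positivity
    rw [Real.dist_eq]
    linarith [hc z]
  exact Continuous.exists_forall_le (f := fun z => f z + (z - a) ^ 2 / (2 * x)) (by fun_prop)
    (Filter.tendsto_atTop_mono hbound
      (Filter.tendsto_atTop_add_const_right _ _ (tendsto_dist_right_cocompact_atTop _)))

/-- For a strictly convex `ℓ : ℝ → ℝ` and `x > 0`, the Moreau envelope
`a ↦ M_ℓ(a; x) = inf_z [ ℓ(z) + (z − a)²/(2x) ]` is strictly convex on `ℝ`. -/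
theorem moreau_envelope_strictly_convex
    (ℓ : ℝ → ℝ) (hconv : StrictConvexOn ℝ Set.univ ℓ) (x : ℝ) (hx : 0 < x) :
    StrictConvexOn ℝ Set.univ
      (fun a : ℝ => ⨅ z : ℝ, (ℓ z + (z - a) ^ 2 / (2 * x))) := by
  choose p hp using hconv.convexOn.exists_forall_add_sq_div_le hx
  have henv (a : ℝ) : ⨅ z : ℝ, (ℓ z + (z - a) ^ 2 / (2 * x)) =
      ℓ (p a) + (p a - a) ^ 2 / (2 * x) :=
    (show IsLeast (Set.range fun z => ℓ z + (z - a) ^ 2 / (2 * x)) _ from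
      ⟨⟨p a, rfl⟩, Set.forall_mem_range.2 (hp a)⟩).csInf_eq
  simp only [henv]
  refine ⟨convex_univ, fun a _ b _ hab s t hs ht hst => ?_⟩
  refine (hp _ (s • p a + t • p b)).trans_lt ?_
  simp only [smul_eq_mul]
  have hquad : (s * p a + t * p b - (s * a + t * b)) ^ 2 / (2 * x) =
      s * ((p a - a) ^ 2 / (2 * x)) + t * ((p b - b) ^ 2 / (2 * x))
        - s * t * ((p a - a) - (p b - b)) ^ 2 / (2 * x) := by
    obtain rfl : t = 1 - s := by linarith
    field_simp
    ring
  rw [hquad]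
  by_cases hpq : p a = p b
  · have h1 : s * p a + t * p b = p b := by rw [hpq, ← add_mul, hst, one_mul]
    have h2 : s * ℓ (p b) + t * ℓ (p b) = ℓ (p b) := by rw [← add_mul, hst, one_mul]
    have h3 : (p a - a) - (p b - b) ≠ 0 := by
      rw [hpq]
      intro h
      exact hab (by linarith)
    have h4 : 0 < s * t * ((p a - a) - (p b - b)) ^ 2 / (2 * x) := by positivity
    rw [h1]
    rw [hpq] at h4 ⊢
    linarith
  · have h1 := hconv.2 (Set.mem_univ (p a)) (Set.mem_univ (p b)) hpq hs ht hst
    simp only [smul_eq_mul] at h1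
    have h2 : 0 ≤ s * t * ((p a - a) - (p b - b)) ^ 2 / (2 * x) := by positivity
    linarith
end

section
/- Let h : (0, ∞) → ℝ be twice differentiable with h(τ) > 0 and h''(τ) ≤ 0 for all τ > 0. Then the function b(x, τ) = x² / (2 h(τ)) is jointly convex on ℝ × (0, ∞). -/
theorem two_mul_mul_sub_sq_mul_le_sq_div {k : ℝ} (hk : 0 < k) (t x : ℝ) :
    2 * t * x - t ^ 2 * k ≤ x ^ 2 / k := by
  rw [le_div_iff₀ hk]
  nlinarith [sq_nonneg (x - t * k)]

/-- The function `(x, y) ↦ x² / (2 f y)` is jointly convex whenever `f` is concave and positive. -/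
theorem ConcaveOn.convexOn_sq_div_two_mul {E : Type*} [AddCommGroup E] [Module ℝ E]
    {s : Set E} {f : E → ℝ} (hf : ConcaveOn ℝ s f) (hpos : ∀ y ∈ s, 0 < f y) :
    ConvexOn ℝ (Set.univ ×ˢ s) (fun p : ℝ × E => p.1 ^ 2 / (2 * f p.2)) := by
  refine ⟨convex_univ.prod hf.1, ?_⟩
  rintro ⟨x, u⟩ ⟨-, hu⟩ ⟨y, v⟩ ⟨-, hv⟩ a b ha hb hab
  have hmid := hf.2 hu hv ha hb hab
  have hm := hpos _ (hf.1 hu hv ha hb hab)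
  have hfu := hpos u hu
  have hfv := hpos v hv
  simp only [Prod.smul_mk, Prod.mk_add_mk, smul_eq_mul] at hmid ⊢
  set m := f (a • u + b • v)
  set t := (a * x + b * y) / (2 * m) with ht
  have hx := mul_le_mul_of_nonneg_left
    (two_mul_mul_sub_sq_mul_le_sq_div (mul_pos two_pos hfu) t x) ha
  have hy := mul_le_mul_of_nonneg_left
    (two_mul_mul_sub_sq_mul_le_sq_div (mul_pos two_pos hfv) t y) hb
  have heq : (a * x + b * y) ^ 2 / (2 * m) = 2 * t * (a * x + b * y) - t ^ 2 * (2 * m) := by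
    rw [ht]
    field_simp
    ring
  have hle := mul_le_mul_of_nonneg_left hmid (sq_nonneg t)
  linarith

/-- If `h : (0,∞) → ℝ` is twice differentiable with `h > 0` and `h'' ≤ 0`
on `(0,∞)`, then `b(x, τ) = x² / (2 h(τ))` is jointly convex on `ℝ × (0, ∞)`. -/
theorem perspective_like_jointly_convex
    (h h' h'' : ℝ → ℝ)
    (hd1 : ∀ τ ∈ Set.Ioi (0 : ℝ), HasDerivAt h (h' τ) τ)
    (hd2 : ∀ τ ∈ Set.Ioi (0 : ℝ), HasDerivAt h' (h'' τ) τ)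
    (hpos : ∀ τ ∈ Set.Ioi (0 : ℝ), 0 < h τ)
    (hconc : ∀ τ ∈ Set.Ioi (0 : ℝ), h'' τ ≤ 0) :
    ConvexOn ℝ (Set.univ ×ˢ Set.Ioi (0 : ℝ))
      (fun p : ℝ × ℝ => p.1 ^ 2 / (2 * h p.2)) := by
  refine ConcaveOn.convexOn_sq_div_two_mul ?_ hpos
  refine concaveOn_of_hasDerivWithinAt2_nonpos (f' := h') (f'' := h'') (convex_Ioi 0)
    (fun τ hτ => (hd1 τ hτ).continuousAt.continuousWithinAt) ?_ ?_ ?_ <;>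
  rw [interior_Ioi]
  · exact fun τ hτ => (hd1 τ hτ).hasDerivWithinAt
  · exact fun τ hτ => (hd2 τ hτ).hasDerivWithinAt
  · exact hconc
end

section
/- Let μ be a probability measure supported on [κ_min, κ_max] with 0 < κ_min ≤ κ_max < ∞, let μ₁ ≠ 0 and μ⋆ > 0 be real constants, set θ = 1/(μ₁² κ_max + μ⋆²), γ₁(κ) = κ/(μ₁² κ + μ⋆²), γ₂(κ) = 1/(μ₁² κ + μ⋆²) − θ, and let e ∈ (0, 1]. Then the function g(t) = −μ₁² t + 1 / ( e · ∫ γ₁(κ)/(γ₂(κ) + t) dμ(κ) ) is strictly increasing on (0, ∞). -/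
open MeasureTheory

lemma integrable_div_add {α : Type*} [MeasurableSpace α] (μ : Measure α) [IsFiniteMeasure μ]
    {f h : α → ℝ} (hf : Measurable f) (hh : Measurable h) {C : ℝ}
    (hf0 : ∀ᵐ x ∂μ, 0 < f x) (hfC : ∀ᵐ x ∂μ, f x ≤ C) (hh0 : ∀ᵐ x ∂μ, 0 ≤ h x)
    {t : ℝ} (ht : 0 < t) : Integrable (fun x => f x / (h x + t)) μ := by
  refine Integrable.of_bound (hf.div (hh.add_const t)).aestronglyMeasurable (C / t) ?_
  filter_upwards [hf0, hfC, hh0] with x h1 h2 h3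
  rw [Real.norm_of_nonneg (by positivity)]
  exact div_le_div₀ (h1.le.trans h2) h2 ht (by linarith)

lemma integral_div_add_pos {α : Type*} [MeasurableSpace α] (μ : Measure α)
    [IsProbabilityMeasure μ] {f h : α → ℝ} (hf : Measurable f) (hh : Measurable h) {C : ℝ}
    (hf0 : ∀ᵐ x ∂μ, 0 < f x) (hfC : ∀ᵐ x ∂μ, f x ≤ C) (hh0 : ∀ᵐ x ∂μ, 0 ≤ h x)
    {t : ℝ} (ht : 0 < t) : 0 < ∫ x, f x / (h x + t) ∂μ := by
  have hpos : ∀ᵐ x ∂μ, 0 < f x / (h x + t) := by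
    filter_upwards [hf0, hh0] with x h1 h2
    positivity
  have hnonneg : 0 ≤ᵐ[μ] fun x => f x / (h x + t) := hpos.mono fun _ hx => hx.le
  refine lt_of_le_of_ne (integral_nonneg_of_ae hnonneg) fun h0 => ?_
  have hzero := (integral_eq_zero_iff_of_nonneg_ae hnonneg
    (integrable_div_add μ hf hh hf0 hfC hh0 ht)).1 h0.symm
  obtain ⟨x, hx, hx'⟩ := (hpos.and hzero).exists
  exact hx.ne' hx'

/-- The reciprocal of a Stieltjes-type transform of a density bounded by `C` grows at rate at
least `1 / C`. -/
lemma inv_integral_div_add_growth {α : Type*} [MeasurableSpace α] (μ : Measure α)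
    [IsProbabilityMeasure μ] {f h : α → ℝ} (hf : Measurable f) (hh : Measurable h) {C : ℝ}
    (hC : 0 < C) (hf0 : ∀ᵐ x ∂μ, 0 < f x) (hfC : ∀ᵐ x ∂μ, f x ≤ C)
    (hh0 : ∀ᵐ x ∂μ, 0 ≤ h x) {s t : ℝ} (hs : 0 < s) (hst : s ≤ t) :
    1 / (∫ x, f x / (h x + s) ∂μ) + (t - s) / C ≤ 1 / ∫ x, f x / (h x + t) ∂μ := by
  have hIs := integral_div_add_pos μ hf hh hf0 hfC hh0 hs
  have hIt := integral_div_add_pos μ hf hh hf0 hfC hh0 (hs.trans_le hst)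
  have hints := integrable_div_add μ hf hh hf0 hfC hh0 hs
  have hintt := integrable_div_add μ hf hh hf0 hfC hh0 (hs.trans_le hst)
  set I := ∫ x, f x / (h x + s) ∂μ
  obtain ⟨d, rfl⟩ : ∃ d, t = s + d := ⟨t - s, by ring⟩
  have hd : 0 ≤ d := by linarith
  set m := I / C with hm
  have hm0 : 0 < m := by positivity
  have hI : I = m * C := by rw [hm]; field_simp
  -- tangent line bound for the concave function `y ↦ y / (1 + d * y)` at `m`
  have hle : ∫ x, f x / (h x + (s + d)) ∂μ ≤
      ∫ x, (f x / (h x + s) + d * m ^ 2 * C) / (1 + d * m) ^ 2 ∂μ := by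
    refine integral_mono_ae hintt ((hints.add (integrable_const _)).div_const _) ?_
    filter_upwards [hf0, hfC, hh0] with x h1 h2 h3
    have hy : 0 < h x + s := by linarith
    have hyd : 0 < h x + (s + d) := by linarith
    have key : f x / (h x + (s + d)) ≤
        (f x / (h x + s) + d * m ^ 2 * f x) / (1 + d * m) ^ 2 := by
      have : (f x / (h x + s) + d * m ^ 2 * f x) / (1 + d * m) ^ 2 - f x / (h x + (s + d)) =
          f x * d * (m * (h x + s) - 1) ^ 2 /
            ((h x + s) * (h x + (s + d)) * (1 + d * m) ^ 2) := by
        have : 1 + d * m ≠ 0 := by positivity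
        field_simp
        ring
      have : 0 ≤ f x * d * (m * (h x + s) - 1) ^ 2 /
            ((h x + s) * (h x + (s + d)) * (1 + d * m) ^ 2) := by positivity
      linarith
    refine key.trans ?_
    gcongr
  rw [integral_div, integral_add hints (integrable_const _), integral_const] at hle
  simp only [probReal_univ, one_smul] at hle
  change _ ≤ (I + _) / _ at hle
  have hbound : (I + d * m ^ 2 * C) / (1 + d * m) ^ 2 = (1 / I + (s + d - s) / C)⁻¹ := by
    have : 1 + d * m ≠ 0 := by positivity
    rw [hI, add_sub_cancel_left, show 1 / (m * C) + d / C = (1 + d * m) / (m * C) by field_simp,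
      inv_div]
    field_simp
  rw [hbound] at hle
  rw [one_div (∫ x, f x / (h x + (s + d)) ∂μ)]
  exact (le_inv_comm₀ hIt (by rw [add_sub_cancel_left]; positivity)).1 hle

/-- With `μ` a probability measure supported on `[κmin, κmax] ⊂ (0,∞)`,
`μ₁ ≠ 0`, `μ⋆ > 0`, `θ = 1/(μ₁²κmax + μ⋆²)`, `γ₁(κ) = κ/(μ₁²κ + μ⋆²)`,
`γ₂(κ) = 1/(μ₁²κ + μ⋆²) − θ`, and `e ∈ (0,1]`, the function
`g(t) = −μ₁²t + 1/(e·∫ γ₁(κ)/(γ₂(κ)+t) dμ(κ))` is strictly increasing on `(0, ∞)`. -/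
theorem g_strictMonoOn
    (μ : Measure ℝ) [IsProbabilityMeasure μ]
    (κmin κmax : ℝ) (hκmin : 0 < κmin) (hκ : κmin ≤ κmax)
    (hsupp : μ (Set.Icc κmin κmax)ᶜ = 0)
    (μ₁ μstar : ℝ) (hμ₁ : μ₁ ≠ 0) (hμstar : 0 < μstar)
    (e : ℝ) (he : e ∈ Set.Ioc (0 : ℝ) 1) :
    StrictMonoOn
      (fun t : ℝ => -μ₁ ^ 2 * t +
        1 / (e * ∫ κ, (κ / (μ₁ ^ 2 * κ + μstar ^ 2)) /
          ((1 / (μ₁ ^ 2 * κ + μstar ^ 2) - 1 / (μ₁ ^ 2 * κmax + μstar ^ 2)) + t) ∂μ))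
      (Set.Ioi (0 : ℝ)) := by
  have hκmax : 0 < κmax := hκmin.trans_le hκ
  have hmem : ∀ᵐ κ ∂μ, κ ∈ Set.Icc κmin κmax := hsupp
  have hD : 0 < μ₁ ^ 2 * κmax + μstar ^ 2 := by positivity
  set f : ℝ → ℝ := fun κ => κ / (μ₁ ^ 2 * κ + μstar ^ 2) with hf_def
  set h : ℝ → ℝ := fun κ =>
    1 / (μ₁ ^ 2 * κ + μstar ^ 2) - 1 / (μ₁ ^ 2 * κmax + μstar ^ 2) with hh_def
  have hf : Measurable f := by fun_prop
  have hh : Measurable h := by fun_prop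
  have hf0 : ∀ᵐ κ ∂μ, 0 < f κ := by
    filter_upwards [hmem] with κ hk
    have : 0 < κ := hκmin.trans_le hk.1
    simp only [hf_def]
    positivity
  have hfC : ∀ᵐ κ ∂μ, f κ ≤ f κmax := by
    filter_upwards [hmem] with κ hk
    have : 0 < κ := hκmin.trans_le hk.1
    simp only [hf_def]
    rw [div_le_div_iff₀ (by positivity) hD]
    nlinarith [mul_le_mul_of_nonneg_right hk.2 (sq_nonneg μstar)]
  have hh0 : ∀ᵐ κ ∂μ, 0 ≤ h κ := by
    filter_upwards [hmem] with κ hk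
    have : 0 < κ := hκmin.trans_le hk.1
    simp only [hh_def]
    rw [sub_nonneg]
    have := hk.2
    gcongr
  have hC : 0 < f κmax := by simp only [hf_def]; positivity
  have hrate : μ₁ ^ 2 < 1 / f κmax := by
    simp only [hf_def]
    rw [one_div_div, lt_div_iff₀ hκmax]
    linarith [pow_pos hμstar 2]
  intro s hs t ht hst
  have hs' : 0 < s := hs
  have hgrow := inv_integral_div_add_growth μ hf hh hC hf0 hfC hh0 hs' hst.le
  have hslope : μ₁ ^ 2 * (t - s) < (t - s) / f κmax := by
    have := mul_lt_mul_of_pos_right hrate (sub_pos.2 hst)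
    rwa [one_div_mul_eq_div] at this
  change -μ₁ ^ 2 * s + 1 / (e * ∫ κ, f κ / (h κ + s) ∂μ) <
    -μ₁ ^ 2 * t + 1 / (e * ∫ κ, f κ / (h κ + t) ∂μ)
  rw [← one_div_mul_one_div, ← one_div_mul_one_div]
  have he1 : 1 ≤ 1 / e := (one_le_div he.1).2 he.2
  have hpos : 0 ≤ μ₁ ^ 2 * (t - s) := mul_nonneg (sq_nonneg _) (sub_pos.2 hst).le
  nlinarith [mul_le_mul_of_nonneg_right he1 (hpos.trans hslope.le)]
end

section
/- Let μ be a probability measure supported on [κ_min, κ_max] with 0 < κ_min ≤ κ_max < ∞, let μ₁ ≠ 0 and μ⋆ > 0 be real constants, set θ = 1/(μ₁² κ_max + μ⋆²), γ₁(κ) = κ/(μ₁² κ + μ⋆²), γ₂(κ) = 1/(μ₁² κ + μ⋆²) − θ, and define g̃(t) = ∫ γ₁(κ)/(γ₂(κ) + t) dμ(κ) for t > 0. Then t ↦ 1/g̃(t) is concave on (0, ∞); equivalently 2 g̃'(t)² ≤ g̃''(t) g̃(t) for all t > 0, and this inequality is strict (so 1/g̃ is strictly concave) whenever μ is not a Dirac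 measure. -/
open MeasureTheory

/-- If `b ≥ 0`, the defect in the concavity of `t ↦ (∫ a / (b + t))⁻¹` is governed by the integral
of `a` times a nonnegative function. -/
lemma integral_concavity_defect {Ω : Type*} [MeasurableSpace Ω] {μ : Measure Ω} {a b : Ω → ℝ}
    (hb : ∀ᵐ ω ∂μ, 0 ≤ b ω) (hint : ∀ t : ℝ, 0 < t → Integrable (fun ω => a ω / (b ω + t)) μ)
    {x y α β : ℝ} (hx : 0 < x) (hy : 0 < y) (hα : 0 < α) (hβ : 0 < β) (hαβ : α + β = 1)
    (p q : ℝ) :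
    Integrable (fun ω => a ω * (α * β * (p * (b ω + y) - q * (b ω + x)) ^ 2 /
      ((b ω + x) * (b ω + y) * (b ω + (α * x + β * y))))) μ ∧
    ∫ ω, a ω * (α * β * (p * (b ω + y) - q * (b ω + x)) ^ 2 /
      ((b ω + x) * (b ω + y) * (b ω + (α * x + β * y)))) ∂μ =
      α * p ^ 2 * ∫ ω, a ω / (b ω + x) ∂μ + β * q ^ 2 * ∫ ω, a ω / (b ω + y) ∂μ -
        (α * p + β * q) ^ 2 * ∫ ω, a ω / (b ω + (α * x + β * y)) ∂μ := by
  have ht : 0 < α * x + β * y := by positivity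
  have ix := (hint x hx).const_mul (α * p ^ 2)
  have iy := (hint y hy).const_mul (β * q ^ 2)
  have it := (hint _ ht).const_mul ((α * p + β * q) ^ 2)
  have key : (fun ω => α * p ^ 2 * (a ω / (b ω + x)) + β * q ^ 2 * (a ω / (b ω + y)) -
      (α * p + β * q) ^ 2 * (a ω / (b ω + (α * x + β * y)))) =ᵐ[μ]
      fun ω => a ω * (α * β * (p * (b ω + y) - q * (b ω + x)) ^ 2 /
      ((b ω + x) * (b ω + y) * (b ω + (α * x + β * y)))) := by
    filter_upwards [hb] with ω h
    have h1 : b ω + x ≠ 0 := by positivity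
    have h2 : b ω + y ≠ 0 := by positivity
    have h3 : b ω + (α * x + β * y) ≠ 0 := by positivity
    obtain rfl : β = 1 - α := by linarith
    field_simp
    ring
  refine ⟨((ix.add iy).sub it).congr key, ?_⟩
  rw [← integral_congr_ae key, integral_sub (ix.fun_add iy) it, integral_add ix iy,
    integral_const_mul, integral_const_mul, integral_const_mul]

/-- A weighted harmonic mean `t ↦ (∫ a / (b + t))⁻¹` is concave, and equality in the concavity
inequality forces `b` to be almost surely constant. -/
lemma one_div_integral_div_add_concave {Ω : Type*} [MeasurableSpace Ω] {μ : Measure Ω} [NeZero μ]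
    {a b : Ω → ℝ} (ha : ∀ᵐ ω ∂μ, 0 < a ω) (hb : ∀ᵐ ω ∂μ, 0 ≤ b ω)
    (hint : ∀ t : ℝ, 0 < t → Integrable (fun ω => a ω / (b ω + t)) μ)
    {x y α β : ℝ} (hx : 0 < x) (hy : 0 < y) (hα : 0 < α) (hβ : 0 < β) (hαβ : α + β = 1) :
    α * (1 / ∫ ω, a ω / (b ω + x) ∂μ) + β * (1 / ∫ ω, a ω / (b ω + y) ∂μ) ≤
      1 / ∫ ω, a ω / (b ω + (α * x + β * y)) ∂μ ∧
    (α * (1 / ∫ ω, a ω / (b ω + x) ∂μ) + β * (1 / ∫ ω, a ω / (b ω + y) ∂μ) =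
      1 / ∫ ω, a ω / (b ω + (α * x + β * y)) ∂μ → x ≠ y → ∃ c, ∀ᵐ ω ∂μ, b ω = c) := by
  have hpos : ∀ t : ℝ, 0 < t → 0 < ∫ ω, a ω / (b ω + t) ∂μ := by
    intro t ht
    have h0 : ∀ᵐ ω ∂μ, 0 < a ω / (b ω + t) := by
      filter_upwards [ha, hb] with ω h1 h2
      positivity
    have h1 : 0 ≤ᵐ[μ] fun ω => a ω / (b ω + t) := h0.mono fun ω h => h.le
    refine (integral_nonneg_of_ae h1).lt_of_ne fun h => ?_
    have h2 := (integral_eq_zero_iff_of_nonneg_ae h1 (hint t ht)).1 h.symm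
    obtain ⟨ω, h3, h4⟩ := (h0.and h2).exists
    exact h3.ne' h4
  have ht : 0 < α * x + β * y := by positivity
  have hX := hpos x hx
  have hY := hpos y hy
  have hT := hpos _ ht
  obtain ⟨hi, he⟩ := integral_concavity_defect hb hint hx hy hα hβ hαβ
    (1 / ∫ ω, a ω / (b ω + x) ∂μ) (1 / ∫ ω, a ω / (b ω + y) ∂μ)
  set X := ∫ ω, a ω / (b ω + x) ∂μ
  set Y := ∫ ω, a ω / (b ω + y) ∂μ
  set T := ∫ ω, a ω / (b ω + (α * x + β * y)) ∂μ
  set s := α * (1 / X) + β * (1 / Y) with hs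
  have hspos : 0 < s := by positivity
  have hrhs : α * (1 / X) ^ 2 * X + β * (1 / Y) ^ 2 * Y - s ^ 2 * T = s * (1 - s * T) := by
    rw [mul_sub, mul_one, ← mul_assoc, ← sq, hs]
    congr 1
    field_simp
  rw [hrhs] at he
  have hnn : 0 ≤ᵐ[μ] fun ω => a ω * (α * β * (1 / X * (b ω + y) - 1 / Y * (b ω + x)) ^ 2 /
      ((b ω + x) * (b ω + y) * (b ω + (α * x + β * y)))) := by
    filter_upwards [ha, hb] with ω h1 h2
    simp only [Pi.zero_apply]
    positivity
  constructor
  · rw [le_div_iff₀ hT]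
    have h := integral_nonneg_of_ae hnn
    rw [he] at h
    linarith [nonneg_of_mul_nonneg_right h hspos]
  · intro h hxy
    have hz : s * (1 - s * T) = 0 := by
      rw [h]
      field_simp
      simp
    rw [hz] at he
    have h0 := (integral_eq_zero_iff_of_nonneg_ae hnn hi).1 he
    have hlin : ∀ᵐ ω ∂μ, 1 / X * (b ω + y) = 1 / Y * (b ω + x) := by
      filter_upwards [ha, hb, h0] with ω h1 h2 h3
      have h4 : b ω + x ≠ 0 := by positivity
      have h5 : b ω + y ≠ 0 := by positivity
      have h6 : b ω + (α * x + β * y) ≠ 0 := by positivity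
      simp only [Pi.zero_apply, mul_eq_zero, div_eq_zero_iff, h1.ne', hα.ne', hβ.ne', h4, h5, h6,
        or_false, false_or, pow_eq_zero_iff two_ne_zero] at h3
      exact sub_eq_zero.1 h3
    have hne : 1 / X - 1 / Y ≠ 0 := by
      intro h1
      obtain ⟨ω, h2⟩ := hlin.exists
      rw [← sub_eq_zero.1 h1] at h2
      have h3 := mul_left_cancel₀ (one_div_pos.2 hX).ne' h2
      exact hxy (by linarith)
    refine ⟨(1 / Y * x - 1 / X * y) / (1 / X - 1 / Y), ?_⟩
    filter_upwards [hlin] with ω h1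
    rw [eq_div_iff hne]
    linarith

/-- A probability measure for which a point has full measure is the Dirac measure there. -/
lemma eq_dirac_of_ae_eq {Ω : Type*} [MeasurableSpace Ω] {μ : Measure Ω} [IsProbabilityMeasure μ]
    {c : Ω} (h : ∀ᵐ ω ∂μ, ω = c) : μ = Measure.dirac c := by
  calc μ = μ.map id := Measure.map_id.symm
    _ = μ.map (fun _ => c) := Measure.map_congr h
    _ = Measure.dirac c := by simp [Measure.map_const]

/-- With `μ` a probability measure supported on `[κmin, κmax] ⊂ (0,∞)`,
`μ₁ ≠ 0`, `μ⋆ > 0`, `θ = 1/(μ₁²κmax + μ⋆²)`, `γ₁(κ) = κ/(μ₁²κ + μ⋆²)`,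
`γ₂(κ) = 1/(μ₁²κ + μ⋆²) − θ`, and `g̃(t) = ∫ γ₁(κ)/(γ₂(κ)+t) dμ(κ)`, the function
`t ↦ 1/g̃(t)` is concave on `(0,∞)`, and strictly concave whenever `μ` is not Dirac. -/
theorem one_div_gtilde_concave
    (μ : Measure ℝ) [IsProbabilityMeasure μ]
    (κmin κmax : ℝ) (hκmin : 0 < κmin) (hκ : κmin ≤ κmax)
    (hsupp : μ (Set.Icc κmin κmax)ᶜ = 0)
    (μ₁ μstar : ℝ) (hμ₁ : μ₁ ≠ 0) (hμstar : 0 < μstar) :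
    ConcaveOn ℝ (Set.Ioi (0 : ℝ))
      (fun t : ℝ => 1 / ∫ κ, (κ / (μ₁ ^ 2 * κ + μstar ^ 2)) /
          ((1 / (μ₁ ^ 2 * κ + μstar ^ 2) - 1 / (μ₁ ^ 2 * κmax + μstar ^ 2)) + t) ∂μ) ∧
    ((∀ x : ℝ, μ ≠ Measure.dirac x) →
      StrictConcaveOn ℝ (Set.Ioi (0 : ℝ))
        (fun t : ℝ => 1 / ∫ κ, (κ / (μ₁ ^ 2 * κ + μstar ^ 2)) /
            ((1 / (μ₁ ^ 2 * κ + μstar ^ 2) - 1 / (μ₁ ^ 2 * κmax + μstar ^ 2)) + t) ∂μ)) := by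
  have hmem : ∀ᵐ κ ∂μ, κ ∈ Set.Icc κmin κmax := hsupp
  have hm : 0 < μ₁ ^ 2 := by positivity
  set γ₁ : ℝ → ℝ := fun κ => κ / (μ₁ ^ 2 * κ + μstar ^ 2) with hγ₁
  set γ₂ : ℝ → ℝ :=
    fun κ => 1 / (μ₁ ^ 2 * κ + μstar ^ 2) - 1 / (μ₁ ^ 2 * κmax + μstar ^ 2) with hγ₂
  have ha : ∀ᵐ κ ∂μ, 0 < γ₁ κ := by
    filter_upwards [hmem] with κ h
    have : 0 < κ := hκmin.trans_le h.1
    positivity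
  have hb : ∀ᵐ κ ∂μ, 0 ≤ γ₂ κ := by
    filter_upwards [hmem] with κ h
    have : 0 < κ := hκmin.trans_le h.1
    refine sub_nonneg.2 (one_div_le_one_div_of_le (by positivity) ?_)
    gcongr
    exact h.2
  have hint : ∀ t : ℝ, 0 < t → Integrable (fun κ => γ₁ κ / (γ₂ κ + t)) μ := by
    intro t ht
    refine Integrable.of_bound (C := κmax / μstar ^ 2 / t) ?_ ?_
    · exact Measurable.aestronglyMeasurable (by fun_prop)
    · filter_upwards [hmem, ha, hb] with κ h h1 h2
      have hκ0 : 0 < κ := hκmin.trans_le h.1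
      have hκmax : 0 < κmax := hκ0.trans_le h.2
      rw [Real.norm_of_nonneg (by positivity)]
      have h3 : γ₁ κ ≤ κmax / μstar ^ 2 :=
        div_le_div₀ hκmax.le h.2 (by positivity) (le_add_of_nonneg_left (by positivity))
      exact div_le_div₀ (by positivity) h3 ht (le_add_of_nonneg_left h2)
  refine ⟨concaveOn_iff_forall_pos.2 ⟨convex_Ioi 0, ?_⟩, fun hdirac => ⟨convex_Ioi 0, ?_⟩⟩
  · intro x hx y hy α β hα hβ hαβ
    exact (one_div_integral_div_add_concave ha hb hint hx hy hα hβ hαβ).1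
  · intro x hx y hy hxy α β hα hβ hαβ
    obtain ⟨hle, heq⟩ := one_div_integral_div_add_concave ha hb hint hx hy hα hβ hαβ
    refine hle.lt_of_ne fun h => ?_
    obtain ⟨c, hc⟩ := heq h hxy
    refine hdirac (((c + 1 / (μ₁ ^ 2 * κmax + μstar ^ 2))⁻¹ - μstar ^ 2) / μ₁ ^ 2)
      (eq_dirac_of_ae_eq ?_)
    filter_upwards [hc] with κ h1
    rw [← h1, hγ₂, sub_add_cancel, one_div, inv_inv, eq_div_iff hm.ne']
    ring
end

section
/- Let k ≥ 1, λ > 0, let S ⊆ ℝ × ℝ^k be a convex set, let g : ℝ × ℝ^k → ℝ be jointly convex, and define f(ϑ, w) = g(ϑ, w) + (λ/2)‖w‖². Suppose (ϑ̂, ŵ) ∈ S minimizes f over S, and suppose ϑ* ∈ ℝ and ŵ' ∈ ℝ^k are such that (ϑ*, ŵ') ∈ S and ŵ' minimizes w ↦ f(ϑ*, w) over { w : (ϑ*, w) ∈ S }. Then (λ/2)‖ŵ − ŵ'‖² ≤ f(ϑ*, ŵ') − f(ϑ̂, ŵ). -/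
/-- The squared norm along a segment. -/
theorem norm_sq_segment {E : Type*} [NormedAddCommGroup E] [InnerProductSpace ℝ E]
    (x y : E) {a b : ℝ} (hab : a + b = 1) :
    ‖a • x + b • y‖ ^ 2 = a * ‖x‖ ^ 2 + b * ‖y‖ ^ 2 - a * b * ‖x - y‖ ^ 2 := by
  obtain rfl : a = 1 - b := by linarith
  rw [norm_add_sq_real, norm_sub_sq_real, norm_smul, norm_smul, mul_pow, mul_pow,
    Real.norm_eq_abs, Real.norm_eq_abs, sq_abs, sq_abs, real_inner_smul_left,
    real_inner_smul_right]
  ring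

theorem le_of_forall_one_sub_mul_le {A G : ℝ}
    (h : ∀ t : ℝ, 0 < t → t < 1 → (1 - t) * A ≤ G) : A ≤ G := by
  have hlim : Filter.Tendsto (fun t : ℝ => (1 - t) * A) (nhdsWithin 0 (Set.Ioi 0)) (nhds A) := by
    have hc : Continuous fun t : ℝ => (1 - t) * A := by fun_prop
    simpa using (hc.tendsto 0).mono_left nhdsWithin_le_nhds
  refine le_of_tendsto hlim ?_
  filter_upwards [Ioo_mem_nhdsGT (zero_lt_one (α := ℝ))] with t ht using h t ht.1 ht.2

/-- Quadratic growth at a minimizer of a convex function plus a ridge penalty in the second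
variable. -/
theorem ConvexOn.quadratic_growth_of_ridge {V E : Type*} [AddCommGroup V] [Module ℝ V]
    [NormedAddCommGroup E] [InnerProductSpace ℝ E] {S : Set (V × E)} {g : V × E → ℝ}
    (hg : ConvexOn ℝ S g) {lam : ℝ} {p q : V × E} (hp : p ∈ S) (hq : q ∈ S)
    (hmin : ∀ r ∈ S, g p + lam / 2 * ‖p.2‖ ^ 2 ≤ g r + lam / 2 * ‖r.2‖ ^ 2) :
    lam / 2 * ‖p.2 - q.2‖ ^ 2 ≤
      (g q + lam / 2 * ‖q.2‖ ^ 2) - (g p + lam / 2 * ‖p.2‖ ^ 2) := by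
  refine le_of_forall_one_sub_mul_le fun t ht ht1 => ?_
  have hab : (1 - t) + t = 1 := by ring
  have hm := hmin _ (hg.1 hp hq (sub_nonneg.2 ht1.le) ht.le hab)
  have hc := hg.2 hp hq (sub_nonneg.2 ht1.le) ht.le hab
  rw [Prod.snd_add, Prod.smul_snd, Prod.smul_snd, norm_sq_segment _ _ hab] at hm
  simp only [smul_eq_mul] at hc
  refine le_of_mul_le_mul_left ?_ ht
  linarith

/-- For jointly convex `g` and `f(ϑ, w) = g(ϑ, w) + (λ/2)‖w‖²`, if
`(ϑ̂, ŵ)` minimizes `f` over a convex set `S` and `ŵ'` minimizes `w ↦ f(ϑ*, w)` over the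
`ϑ*`-slice of `S`, then `(λ/2)‖ŵ − ŵ'‖² ≤ f(ϑ*, ŵ') − f(ϑ̂, ŵ)`. -/
theorem fixed_scalar_gap_controls_distance
    (k : ℕ) (hk : 1 ≤ k) (lam : ℝ) (hlam : 0 < lam)
    (S : Set (ℝ × EuclideanSpace ℝ (Fin k))) (hS : Convex ℝ S)
    (g : ℝ × EuclideanSpace ℝ (Fin k) → ℝ) (hg : ConvexOn ℝ Set.univ g)
    (ϑhat ϑstar : ℝ) (what w' : EuclideanSpace ℝ (Fin k))
    (hmem : (ϑhat, what) ∈ S)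
    (hmin : ∀ p ∈ S, g (ϑhat, what) + lam / 2 * ‖what‖ ^ 2 ≤ g p + lam / 2 * ‖p.2‖ ^ 2)
    (hmem' : (ϑstar, w') ∈ S)
    (hmin' : ∀ w : EuclideanSpace ℝ (Fin k), (ϑstar, w) ∈ S →
      g (ϑstar, w') + lam / 2 * ‖w'‖ ^ 2 ≤ g (ϑstar, w) + lam / 2 * ‖w‖ ^ 2) :
    lam / 2 * ‖what - w'‖ ^ 2 ≤
      (g (ϑstar, w') + lam / 2 * ‖w'‖ ^ 2) -
        (g (ϑhat, what) + lam / 2 * ‖what‖ ^ 2) := by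
  have hgS : ConvexOn ℝ S g := hg.subset (Set.subset_univ S) hS
  exact ConvexOn.quadratic_growth_of_ridge (p := (ϑhat, what)) (q := (ϑstar, w')) hgS
    hmem hmem' hmin
end

section
/- Let f, g : ℝ → ℝ be concave functions such that f attains its maximum, g attains its maximum, and f + g attains its maximum at a point c ∈ ℝ. Then there exist a ∈ ℝ maximizing f and b ∈ ℝ maximizing g such that min(a, b) ≤ c ≤ max(a, b); equivalently, c = γ a + (1 − γ) b for some γ ∈ [0, 1]. -/
/-- If a maximizer `b` of `g` lies between a maximizer `a` of the concave function `f` and a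
maximizer `c` of `f + g`, then `c` maximizes `g`. -/
theorem ConcaveOn.isMax_of_mem_segment {f g : ℝ → ℝ} (hf : ConcaveOn ℝ Set.univ f)
    {a b c : ℝ} (ha : ∀ x, f x ≤ f a) (hb : ∀ x, g x ≤ g b)
    (hc : ∀ x, f x + g x ≤ f c + g c) (h : b ∈ segment ℝ a c) (x : ℝ) : g x ≤ g c := by
  have hmin := hf.ge_on_segment (Set.mem_univ a) (Set.mem_univ c) h
  rw [min_eq_right (ha c)] at hmin
  linarith [hb x, hc b]

/-- If `f, g : ℝ → ℝ` are concave, each attains its maximum, and `f + g`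
attains its maximum at `c`, then there are maximizers `a` of `f` and `b` of `g` with
`min a b ≤ c ≤ max a b`. -/
theorem maximizer_of_sum_between_maximizers
    (f g : ℝ → ℝ)
    (hf : ConcaveOn ℝ Set.univ f) (hg : ConcaveOn ℝ Set.univ g)
    (hfmax : ∃ a : ℝ, ∀ x, f x ≤ f a) (hgmax : ∃ b : ℝ, ∀ x, g x ≤ g b)
    (c : ℝ) (hc : ∀ x, f x + g x ≤ f c + g c) :
    ∃ a b : ℝ, (∀ x, f x ≤ f a) ∧ (∀ x, g x ≤ g b) ∧ min a b ≤ c ∧ c ≤ max a b := by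
  obtain ⟨a, ha⟩ := hfmax
  obtain ⟨b, hb⟩ := hgmax
  have hc' : ∀ x, g x + f x ≤ g c + f c := fun x => by linarith [hc x]
  by_cases hbac : b ∈ segment ℝ a c
  · exact ⟨a, c, ha, hf.isMax_of_mem_segment ha hb hc hbac, min_le_right _ _, le_max_right _ _⟩
  by_cases habc : a ∈ segment ℝ b c
  · exact ⟨c, b, hg.isMax_of_mem_segment hb ha hc' habc, hb, min_le_left _ _, le_max_left _ _⟩
  refine ⟨a, b, ha, hb, ?_⟩
  rw [segment_eq_uIcc, Set.mem_uIcc] at hbac habc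
  grind
end
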